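/- Almost-sure eventually synchronizing is characterized as follows: a Dirac initial state q₀ is almost-sure winning for eventually synchronizing in T if and only if there exists a set U ⊆ Q such that q₀ is sure winning for eventually synchronizing in U, and the uniform distribution on U is limit-sure eventually synchronizing in T with support in U. -/

import Mathlib

open Finset

structure MDP (Q A : Type) [Fintype Q] [Fintype A] where
  δ : Q → A → Q → ℝ
  nonneg : ∀ q a q', 0 ≤ δ q a q'
  sum_one : ∀ q a, ∑ q', δ q a q' = 1

structure Strat (Q A : Type) [Fintype A] where
  σ : List Q → A → ℝ
  nonneg : ∀ h a, 0 ≤ σ h a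
  sum_one : ∀ h, ∑ a, σ h a = 1

variable {Q A : Type} [Fintype Q] [DecidableEq Q] [Fintype A]

/-- Probability of a path of length `n` (i.e. `n+1` states) from initial
distribution `μ0` under strategy `α`. The history passed to the strategy is
the list of visited states, most recent first. -/
noncomputable def pathProb (M : MDP Q A) (μ0 : Q → ℝ) (α : Strat Q A)
    {n : ℕ} (π : Fin (n + 1) → Q) : ℝ :=
  μ0 (π 0) *
    ∏ i : Fin n,
      ∑ a,
        α.σ (List.ofFn (fun j : Fin (i.1 + 1) =>
            π ⟨i.1 - j.1, lt_of_le_of_lt (Nat.sub_le i.1 j.1) (Nat.lt_succ_of_lt i.isLt)⟩)) a *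
          M.δ (π i.castSucc) a (π i.succ)

/-- Distribution over states after `n` steps. -/
noncomputable def Mdist (M : MDP Q A) (μ0 : Q → ℝ) (α : Strat Q A) (n : ℕ) (q : Q) : ℝ :=
  ∑ π : Fin (n + 1) → Q, if π (Fin.last n) = q then pathProb M μ0 α π else 0

/-- Probability mass in `T` after `n` steps. -/
noncomputable def Mmass (M : MDP Q A) (μ0 : Q → ℝ) (α : Strat Q A) (n : ℕ) (T : Finset Q) : ℝ :=
  ∑ q ∈ T, Mdist M μ0 α n q

open scoped Classical in
/-- Support of the transition `δ(q,a)`. -/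
noncomputable def post (M : MDP Q A) (q : Q) (a : A) : Finset Q :=
  Finset.univ.filter (fun q' => 0 < M.δ q a q')

open scoped Classical in
/-- One-step predecessor operator. -/
noncomputable def PreM (M : MDP Q A) (S : Finset Q) : Finset Q :=
  Finset.univ.filter (fun q => ∃ a, post M q a ⊆ S)

def IsDist (μ : Q → ℝ) : Prop := (∀ q, 0 ≤ μ q) ∧ ∑ q, μ q = 1

def dirac (q0 : Q) : Q → ℝ := fun q => if q = q0 then (1 : ℝ) else 0

def PureStrat (α : Strat Q A) : Prop := ∀ h, ∃ a, α.σ h a = 1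

/-- Uniform distribution on a finset. -/
noncomputable def uniformOn {Q : Type} [Fintype Q] [DecidableEq Q] (U : Finset Q) :
    Q → ℝ := fun q => if q ∈ U then (U.card : ℝ)⁻¹ else 0

/-- Probability that the strategy `α` moves from `q` to `q'` when the history is `q :: h`. -/
noncomputable def stepProb (M : MDP Q A) (α : Strat Q A) (q : Q) (h : List Q) (q' : Q) : ℝ :=
  ∑ a, α.σ (q :: h) a * M.δ q a q'

/-- Expected value of `f` at the state reached `n` steps after the history `q :: h`. -/
noncomputable def expVal (M : MDP Q A) (α : Strat Q A) (f : Q → ℝ) : ℕ → Q → List Q → ℝ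
  | 0, q, _ => f q
  | n + 1, q, h => ∑ q', stepProb M α q h q' * expVal M α f n q' (q :: h)

/-- The real-valued indicator function of a finset. -/
def ind {Q : Type} [DecidableEq Q] (T : Finset Q) : Q → ℝ := fun q => if q ∈ T then 1 else 0

lemma ind_nonneg {Q : Type} [DecidableEq Q] (T : Finset Q) (q : Q) : 0 ≤ ind T q := by
  unfold ind; split_ifs <;> norm_num

lemma stepProb_nonneg {Q A : Type} [Fintype Q] [Fintype A] (M : MDP Q A) (α : Strat Q A)
    (q : Q) (h : List Q) (q' : Q) : 0 ≤ stepProb M α q h q' :=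
  Finset.sum_nonneg fun a _ => mul_nonneg (α.nonneg _ a) (M.nonneg _ _ _)

lemma sum_stepProb {Q A : Type} [Fintype Q] [Fintype A] (M : MDP Q A) (α : Strat Q A)
    (q : Q) (h : List Q) : ∑ q', stepProb M α q h q' = 1 := by
  unfold stepProb
  rw [Finset.sum_comm]
  simp only [← Finset.mul_sum, M.sum_one, mul_one, α.sum_one]

section expVal

variable {Q A : Type} [Fintype Q] [Fintype A] (M : MDP Q A)

lemma expVal_nonneg (α : Strat Q A) {f : Q → ℝ} (hf : ∀ q, 0 ≤ f q) (n : ℕ) (q : Q)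
    (h : List Q) : 0 ≤ expVal M α f n q h := by
  induction n generalizing q h with
  | zero => exact hf q
  | succ n ih =>
    exact Finset.sum_nonneg fun q' _ => mul_nonneg (stepProb_nonneg M α q h q') (ih _ _)

lemma expVal_mono (α : Strat Q A) {f g : Q → ℝ} (hfg : ∀ q, f q ≤ g q) (n : ℕ) (q : Q)
    (h : List Q) : expVal M α f n q h ≤ expVal M α g n q h := by
  induction n generalizing q h with
  | zero => exact hfg q
  | succ n ih =>
    exact Finset.sum_le_sum fun q' _ =>
      mul_le_mul_of_nonneg_left (ih _ _) (stepProb_nonneg M α q h q')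

lemma expVal_one (α : Strat Q A) (n : ℕ) (q : Q) (h : List Q) :
    expVal M α (fun _ => 1) n q h = 1 := by
  induction n generalizing q h with
  | zero => rfl
  | succ n ih => simp only [expVal, ih, mul_one, sum_stepProb]

lemma expVal_add (α : Strat Q A) (f g : Q → ℝ) (n : ℕ) (q : Q) (h : List Q) :
    expVal M α (fun p => f p + g p) n q h = expVal M α f n q h + expVal M α g n q h := by
  induction n generalizing q h with
  | zero => rfl
  | succ n ih => simp only [expVal, ih, mul_add, Finset.sum_add_distrib]

/-- Expectations only depend on the strategy at the histories that are visited. -/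
lemma expVal_congr {α β : Strat Q A} (f : Q → ℝ) (n : ℕ) (q : Q) (h : List Q)
    (hαβ : ∀ l : List Q, l.length ≤ h.length + n → α.σ l = β.σ l) :
    expVal M α f n q h = expVal M β f n q h := by
  induction n generalizing q h with
  | zero => rfl
  | succ n ih =>
    simp only [expVal]
    refine Finset.sum_congr rfl fun q' _ => ?_
    rw [ih q' (q :: h) fun l hl => hαβ l (by simp at hl; omega)]
    simp only [stepProb, hαβ (q :: h) (by simp)]

/-- If `β` behaves after `h` as `α` does after `h'`, the corresponding expectations agree. -/
lemma expVal_append {α β : Strat Q A} (f : Q → ℝ) {h h' : List Q} (n : ℕ) (q : Q) (l : List Q)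
    (hαβ : ∀ p l', (p :: l').getLast? = (q :: l).getLast? →
      α.σ (p :: l' ++ h) = β.σ (p :: l' ++ h')) :
    expVal M α f n q (l ++ h) = expVal M β f n q (l ++ h') := by
  induction n generalizing q l with
  | zero => rfl
  | succ n ih =>
    simp only [expVal]
    refine Finset.sum_congr rfl fun q' _ => ?_
    have := ih q' (q :: l) (fun p l' e => hαβ p l' (by rw [e, List.getLast?_cons_cons]))
    simp only [List.cons_append] at this
    rw [this]
    have := hαβ q l rfl
    simp only [List.cons_append] at this
    simp only [stepProb, this]

/-- Concatenation of a bound on the first `n` steps with a bound on the next `m` steps. -/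
lemma mul_expVal_le_expVal_add (α : Strat Q A) {f g : Q → ℝ} {c : ℝ} (n m : ℕ) (q : Q)
    (h : List Q)
    (hfg : ∀ p l, l.length = h.length + n → c * f p ≤ expVal M α g m p l) :
    c * expVal M α f n q h ≤ expVal M α g (n + m) q h := by
  induction n generalizing q h with
  | zero => simpa [expVal] using hfg q h rfl
  | succ n ih =>
    rw [show n + 1 + m = (n + m) + 1 by omega]
    simp only [expVal, Finset.mul_sum]
    refine Finset.sum_le_sum fun q' _ => ?_
    have := ih q' (q :: h) fun p l hl => hfg p l (by simp at hl; omega)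
    have := mul_le_mul_of_nonneg_left this (stepProb_nonneg M α q h q')
    linarith

end expVal

section reach

variable {Q A : Type} [Fintype Q] [DecidableEq Q] [Fintype A] (M : MDP Q A)

lemma expVal_eq_sum (α : Strat Q A) (f : Q → ℝ) (n : ℕ) (q : Q) (h : List Q) :
    expVal M α f n q h = ∑ p, f p * expVal M α (ind {p}) n q h := by
  induction n generalizing q h with
  | zero => simp [expVal, ind]
  | succ n ih =>
    simp only [expVal, Finset.mul_sum]
    rw [Finset.sum_comm]
    refine Finset.sum_congr rfl fun q' _ => ?_
    rw [ih, Finset.mul_sum]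
    exact Finset.sum_congr rfl fun p _ => by ring

lemma expVal_ind_le_one (α : Strat Q A) (T : Finset Q) (n : ℕ) (q : Q) (h : List Q) :
    expVal M α (ind T) n q h ≤ 1 := by
  rw [← expVal_one M α n q h]
  exact expVal_mono M α (fun p => by unfold ind; split_ifs <;> norm_num) n q h

lemma expVal_ind_add_compl (α : Strat Q A) (T : Finset Q) (n : ℕ) (q : Q) (h : List Q) :
    expVal M α (ind T) n q h + expVal M α (ind Tᶜ) n q h = 1 := by
  rw [← expVal_add, ← expVal_one M α n q h]
  congr 1
  funext p
  by_cases hp : p ∈ T <;> simp [ind, hp]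

/-- The states reached with positive probability carry the whole mass. -/
lemma expVal_ind_support (α : Strat Q A) (n : ℕ) (q : Q) (h : List Q) :
    expVal M α (ind (univ.filter fun p => 0 < expVal M α (ind {p}) n q h)) n q h = 1 := by
  rw [← expVal_one M α n q h, expVal_eq_sum, expVal_eq_sum M α (fun _ => 1)]
  refine Finset.sum_congr rfl fun p _ => ?_
  by_cases hp : 0 < expVal M α (ind {p}) n q h
  · simp [ind, hp]
  · have : expVal M α (ind {p}) n q h = 0 :=
      le_antisymm (not_lt.mp hp) (expVal_nonneg M α (ind_nonneg _) n q h)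
    rw [this, mul_zero, mul_zero]

/-- A state reached with positive probability is reached along one history of positive weight. -/
lemma exists_history_of_expVal_pos (α : Strat Q A) (p : Q) (n : ℕ) (q : Q) (h : List Q)
    (hp : 0 < expVal M α (ind {p}) n q h) :
    ∃ (l : List Q) (c : ℝ), 0 < c ∧ ∀ f : Q → ℝ, (∀ r, 0 ≤ f r) → ∀ m,
      c * expVal M α f m p l ≤ expVal M α f (n + m) q h := by
  induction n generalizing q h with
  | zero =>
    have hq : q = p := by
      by_contra hne
      simp [expVal, ind, hne] at hp
    subst hq
    exact ⟨h, 1, one_pos, fun f _ m => by simp⟩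
  | succ n ih =>
    obtain ⟨q', -, hq'⟩ := Finset.exists_lt_of_sum_lt (s := univ) (f := fun _ : Q => (0 : ℝ))
      (by simpa only [Finset.sum_const_zero, expVal] using hp)
    have hs := stepProb_nonneg M α q h q'
    have hs' : 0 < stepProb M α q h q' := by
      refine lt_of_le_of_ne hs fun e => ?_
      rw [← e, zero_mul] at hq'
      exact lt_irrefl _ hq'
    obtain ⟨l, c, hc, hl⟩ := ih q' (q :: h) (pos_of_mul_pos_right hq' hs)
    refine ⟨l, stepProb M α q h q' * c, mul_pos hs' hc, fun f hf m => ?_⟩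
    rw [show n + 1 + m = (n + m) + 1 by omega, mul_assoc]
    refine (mul_le_mul_of_nonneg_left (hl f hf m) hs).trans ?_
    exact Finset.single_le_sum
      (f := fun q' => stepProb M α q h q' * expVal M α f (n + m) q' (q :: h))
      (fun r _ => mul_nonneg (stepProb_nonneg M α q h r) (expVal_nonneg M α hf _ _ _))
      (Finset.mem_univ q')

end reach

/-- The first `i + 1` states of a path, most recent first. -/
def pathHist {Q : Type} {n : ℕ} (π : Fin (n + 1) → Q) (i : Fin n) : List Q :=
  List.ofFn fun j : Fin (i.1 + 1) =>
    π ⟨i.1 - j.1, lt_of_le_of_lt (Nat.sub_le i.1 j.1) (Nat.lt_succ_of_lt i.isLt)⟩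

lemma pathHist_cons_zero {Q : Type} {n : ℕ} (q : Q) (π : Fin (n + 1) → Q) :
    pathHist (Fin.cons q π : Fin (n + 2) → Q) 0 = [q] := by
  simp [pathHist]

lemma pathHist_cons_succ {Q : Type} {n : ℕ} (q : Q) (π : Fin (n + 1) → Q) (i : Fin n) :
    pathHist (Fin.cons q π : Fin (n + 2) → Q) i.succ = pathHist π i ++ [q] := by
  unfold pathHist
  apply List.ext_getElem
  · simp
  intro k hk hk'
  simp only [List.length_ofFn, Fin.val_succ] at hk
  rw [List.getElem_ofFn, List.getElem_append]
  split_ifs with hlt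
  · simp only [List.length_ofFn] at hlt
    rw [List.getElem_ofFn]
    have : (⟨i.succ.1 - k, by simp; omega⟩ : Fin (n + 2))
        = Fin.succ ⟨i.1 - k, by omega⟩ := by
      ext; simp; omega
    simp only [this, Fin.cons_succ]
  · simp only [List.length_ofFn] at hlt
    have : (⟨i.succ.1 - k, by simp; omega⟩ : Fin (n + 2)) = 0 := by
      ext; simp; omega
    simp only [this, Fin.cons_zero, List.getElem_singleton]

/-- Summing over all paths of length `n` from `q` computes the expectation. -/
lemma sum_path_eq_expVal {Q A : Type} [Fintype Q] [Fintype A] (M : MDP Q A)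
    (α : Strat Q A) (f : Q → ℝ) (n : ℕ) (μ : Q → ℝ) (h : List Q) :
    ∑ π : Fin (n + 1) → Q, μ (π 0) *
      (∏ i : Fin n, ∑ a, α.σ (pathHist π i ++ h) a * M.δ (π i.castSucc) a (π i.succ)) *
        f (π (Fin.last n)) = ∑ q, μ q * expVal M α f n q h := by
  induction n generalizing μ h with
  | zero =>
    rw [← (Equiv.funUnique (Fin 1) Q).symm.sum_comp]
    simp [expVal]
  | succ n ih =>
    rw [← (Fin.consEquiv fun _ : Fin (n + 2) => Q).sum_comp, Fintype.sum_prod_type]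
    refine Finset.sum_congr rfl fun q _ => ?_
    simp only [expVal]
    rw [← ih (stepProb M α q h) (q :: h), Finset.mul_sum]
    refine Finset.sum_congr rfl fun π _ => ?_
    simp only [Fin.consEquiv, Equiv.coe_fn_mk, Fin.prod_univ_succ, pathHist_cons_zero,
      pathHist_cons_succ, Fin.castSucc_zero, Fin.cons_zero, Fin.cons_succ, ← Fin.succ_castSucc,
      ← Fin.succ_last, List.append_assoc, List.singleton_append, stepProb]
    ring

section mass

variable {Q A : Type} [Fintype Q] [DecidableEq Q] [Fintype A] (M : MDP Q A)

lemma Mmass_eq_sum_expVal (α : Strat Q A) (μ : Q → ℝ) (n : ℕ) (T : Finset Q) :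
    Mmass M μ α n T = ∑ q, μ q * expVal M α (ind T) n q [] := by
  rw [← sum_path_eq_expVal]
  simp only [Mmass, Mdist]
  rw [Finset.sum_comm]
  refine Finset.sum_congr rfl fun π _ => ?_
  simp [Finset.sum_ite_eq, ind, pathProb, pathHist]

lemma Mmass_dirac (α : Strat Q A) (q : Q) (n : ℕ) (T : Finset Q) :
    Mmass M (dirac q) α n T = expVal M α (ind T) n q [] := by
  simp [Mmass_eq_sum_expVal, dirac]

lemma Mmass_uniformOn (α : Strat Q A) (U : Finset Q) (n : ℕ) (T : Finset Q) :
    Mmass M (uniformOn U) α n T = (U.card : ℝ)⁻¹ * ∑ q ∈ U, expVal M α (ind T) n q [] := by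
  simp only [Mmass_eq_sum_expVal, uniformOn, ite_mul, zero_mul]
  rw [Finset.sum_ite_mem, Finset.univ_inter, Finset.mul_sum]

lemma le_Mmass_uniformOn (α : Strat Q A) {U : Finset Q} (hU : U.Nonempty) (n : ℕ)
    (T : Finset Q) {c : ℝ} (hc : ∀ q ∈ U, c ≤ expVal M α (ind T) n q []) :
    c ≤ Mmass M (uniformOn U) α n T := by
  have hpos : (0 : ℝ) < U.card := by exact_mod_cast hU.card_pos
  rw [Mmass_uniformOn, inv_mul_eq_div, le_div_iff₀ hpos, mul_comm]
  simpa using Finset.card_nsmul_le_sum U _ c hc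

lemma Mmass_uniformOn_le_one (α : Strat Q A) {U : Finset Q} (hU : U.Nonempty) (n : ℕ)
    (T : Finset Q) : Mmass M (uniformOn U) α n T ≤ 1 := by
  have hpos : (0 : ℝ) < U.card := by exact_mod_cast hU.card_pos
  rw [Mmass_uniformOn, inv_mul_eq_div, div_le_iff₀ hpos, one_mul]
  simpa using Finset.sum_le_card_nsmul U _ 1 fun q _ => expVal_ind_le_one M α T n q []

/-- A bound for the uniform distribution yields one for every state of its support. -/
lemma le_expVal_of_le_Mmass_uniformOn (α : Strat Q A) {U : Finset Q} (n : ℕ) (T : Finset Q)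
    {ε : ℝ} (hm : 1 - ε / U.card ≤ Mmass M (uniformOn U) α n T) {q : Q} (hq : q ∈ U) :
    1 - ε ≤ expVal M α (ind T) n q [] := by
  have hpos : (0 : ℝ) < U.card := by exact_mod_cast Finset.card_pos.mpr ⟨q, hq⟩
  rw [Mmass_uniformOn, inv_mul_eq_div, le_div_iff₀ hpos, sub_mul, div_mul_cancel₀ _ hpos.ne',
    one_mul] at hm
  have h1 := Finset.single_le_sum (f := fun p => 1 - expVal M α (ind T) n p [])
    (fun p _ => sub_nonneg.mpr (expVal_ind_le_one M α T n p [])) hq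
  simp only [Finset.sum_sub_distrib, Finset.sum_const, nsmul_eq_mul, mul_one] at h1
  linarith

end mass

section strategies

variable {Q A : Type} [Fintype A]

/-- Play `α` for `n` steps and then `β`, forgetting the first `n` states. -/
def Strat.concat (α : Strat Q A) (n : ℕ) (β : Strat Q A) : Strat Q A where
  σ h := if h.length ≤ n then α.σ h else β.σ (h.take (h.length - n))
  nonneg h a := by
    split_ifs
    exacts [α.nonneg _ _, β.nonneg _ _]
  sum_one h := by
    split_ifs
    exacts [α.sum_one _, β.sum_one _]

/-- Play from initial state `q` as `α` does after the history `q :: g q`. -/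
def Strat.resume (α : Strat Q A) (g : Q → List Q) : Strat Q A where
  σ h := α.σ (h ++ h.getLast?.elim [] g)
  nonneg _ _ := α.nonneg _ _
  sum_one _ := α.sum_one _

variable [Fintype Q] (M : MDP Q A)

lemma expVal_resume (α : Strat Q A) (g : Q → List Q) (f : Q → ℝ) (n : ℕ) (q : Q) :
    expVal M (α.resume g) f n q [] = expVal M α f n q (g q) := by
  have := expVal_append M (α := α.resume g) (β := α) f (h := []) (h' := g q) n q [] ?_
  · simpa using this
  intro p l hl
  simp only [List.append_nil, Strat.resume]
  rw [hl]
  rfl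

lemma expVal_concat_tail (α β : Strat Q A) (f : Q → ℝ) (n m : ℕ) (q : Q) (h : List Q)
    (hh : h.length = n) : expVal M (α.concat n β) f m q h = expVal M β f m q [] := by
  have := expVal_append M (α := α.concat n β) (β := β) f (h := h) (h' := []) m q [] ?_
  · simpa using this
  intro p l _
  have hlen : ¬ (p :: l ++ h).length ≤ n := by simp; omega
  have htake : (p :: l ++ h).take ((p :: l ++ h).length - n) = p :: l := by
    rw [List.length_append, hh, Nat.add_sub_cancel, List.take_left]
  simp only [Strat.concat, hlen, if_false, htake, List.append_nil]

end strategies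

section main

variable {Q A : Type} [Fintype Q] [DecidableEq Q] [Fintype A] (M : MDP Q A)

/-- An almost-sure winning strategy yields the set `U`. -/
lemma exists_support_of_almost_sure (q0 : Q) (T : Finset Q) (α : Strat Q A)
    (hα : ∀ ε : ℝ, 0 < ε → ∃ n : ℕ, 1 - ε ≤ expVal M α (ind T) n q0 []) :
    ∃ (U : Finset Q) (n : ℕ) (β : Strat Q A), expVal M α (ind U) n q0 [] = 1 ∧
      ∀ ε : ℝ, 0 < ε → ∃ m : ℕ, ∀ q ∈ U,
        1 - ε ≤ expVal M β (ind T) m q [] ∧ expVal M β (ind U) m q [] = 1 := by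
  choose N hN using fun i : ℕ => hα (1 / ((i : ℝ) + 1)) Nat.one_div_pos_of_nat
  let supp : ℕ → Finset Q := fun i =>
    univ.filter fun p => 0 < expVal M α (ind {p}) (N i) q0 []
  obtain ⟨U, hU⟩ := Finite.exists_infinite_fiber supp
  have hI : (supp ⁻¹' {U}).Infinite := Set.infinite_coe_iff.mp hU
  have hsupp : ∀ i ∈ supp ⁻¹' {U}, expVal M α (ind U) (N i) q0 [] = 1 := by
    intro i hi
    have hi' : supp i = U := hi
    rw [← hi']
    exact expVal_ind_support M α (N i) q0 []
  obtain ⟨i₀, hi₀, hmin⟩ := (measure N).wf.has_min _ hI.nonempty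
  have hreach : ∀ q, ∃ (l : List Q) (c : ℝ), q ∈ U → 0 < c ∧ ∀ f : Q → ℝ, (∀ r, 0 ≤ f r) →
      ∀ m, c * expVal M α f m q l ≤ expVal M α f (N i₀ + m) q0 [] := by
    intro q
    by_cases hq : q ∈ U
    · have hi' : supp i₀ = U := hi₀
      rw [← hi'] at hq
      obtain ⟨l, c, hlc⟩ :=
        exists_history_of_expVal_pos M α q (N i₀) q0 [] (Finset.mem_filter.mp hq).2
      exact ⟨l, c, fun _ => hlc⟩
    · exact ⟨[], 0, fun h => absurd h hq⟩
  choose g c hgc using hreach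
  refine ⟨U, N i₀, α.resume g, hsupp i₀ hi₀, fun ε hε => ?_⟩
  have hne : U.Nonempty := by
    rw [Finset.nonempty_iff_ne_empty]
    rintro rfl
    have h1 := hsupp i₀ hi₀
    rw [expVal_eq_sum] at h1
    simp [ind] at h1
  obtain ⟨p, hp, hpmin⟩ := Finset.exists_min_image U c hne
  have hcp := (hgc p hp).1
  obtain ⟨k, hk⟩ := exists_nat_one_div_lt (mul_pos hcp hε)
  obtain ⟨i, hi, hki⟩ := hI.exists_gt k
  have hle : N i₀ ≤ N i := not_lt.mp (hmin i hi)
  refine ⟨N i - N i₀, fun q hq => ?_⟩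
  have hcq := (hgc q hq).1
  have key : ∀ S : Finset Q, c q * (1 - expVal M α (ind S) (N i - N i₀) q (g q)) ≤
      1 - expVal M α (ind S) (N i) q0 [] := by
    intro S
    have h1 := (hgc q hq).2 (ind Sᶜ) (ind_nonneg _) (N i - N i₀)
    rw [Nat.add_sub_cancel' hle] at h1
    have h2 := expVal_ind_add_compl M α S (N i - N i₀) q (g q)
    have h3 := expVal_ind_add_compl M α S (N i) q0 []
    rw [← eq_sub_iff_add_eq'] at h2 h3
    rwa [← h2, ← h3]
  rw [expVal_resume, expVal_resume]
  constructor
  · have h1 := key T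
    have h2 : (1 : ℝ) / ((i : ℝ) + 1) ≤ 1 / ((k : ℝ) + 1) :=
      Nat.one_div_le_one_div hki.le
    have h3 : c p * ε ≤ c q * ε := mul_le_mul_of_nonneg_right (hpmin q hq) hε.le
    have h4 := hN i
    have h5 : c q * (1 - expVal M α (ind T) (N i - N i₀) q (g q)) ≤ c q * ε := by linarith
    have h6 := le_of_mul_le_mul_left h5 hcq
    linarith
  · refine le_antisymm (expVal_ind_le_one M α _ _ _ _) ?_
    have h1 := key U
    rw [hsupp i hi, sub_self] at h1
    have h2 := nonpos_of_mul_nonpos_right h1 hcq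
    linarith

/-- A strategy surely in `U` at time `t` can be modified after time `t` so as to be in `T` with
high probability, and surely in `U`, at a later time. -/
lemma exists_extension {q0 : Q} {T U : Finset Q} (hUT : ¬ U ⊆ T)
    (hlim : ∀ ε : ℝ, 0 < ε → ∃ (β : Strat Q A) (m : ℕ), ∀ q ∈ U,
      1 - ε ≤ expVal M β (ind T) m q [] ∧ expVal M β (ind U) m q [] = 1)
    (α : Strat Q A) (t : ℕ) (hα : expVal M α (ind U) t q0 [] = 1) {ε : ℝ} (hε : 0 < ε) :
    ∃ (α' : Strat Q A) (t' : ℕ), expVal M α' (ind U) t' q0 [] = 1 ∧ t < t' ∧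
      (∀ l : List Q, l.length ≤ t → α'.σ l = α.σ l) ∧
      1 - ε ≤ expVal M α' (ind T) t' q0 [] := by
  obtain ⟨β, m, hβ⟩ := hlim (min ε (1 / 2)) (by positivity)
  obtain ⟨p, hpU, hpT⟩ := Finset.not_subset.mp hUT
  have hm : 0 < m := by
    refine Nat.pos_of_ne_zero ?_
    rintro rfl
    have h1 := (hβ p hpU).1
    simp only [expVal, ind, hpT, if_false] at h1
    have h2 := min_le_right ε (1 / 2)
    linarith
  have hagree : ∀ l : List Q, l.length ≤ t → (α.concat t β).σ l = α.σ l := fun l hl => by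
    simp [Strat.concat, hl]
  have hU : expVal M (α.concat t β) (ind U) t q0 [] = 1 := by
    rw [← hα]
    exact expVal_congr M _ _ _ _ fun l hl => hagree l (by simpa using hl)
  have key : ∀ (S : Finset Q) (c : ℝ), (∀ q ∈ U, c ≤ expVal M β (ind S) m q []) →
      c ≤ expVal M (α.concat t β) (ind S) (t + m) q0 [] := by
    intro S c hS
    have h1 := mul_expVal_le_expVal_add M (α.concat t β) (f := ind U) (g := ind S) (c := c)
      t m q0 [] ?_
    · rwa [hU, mul_one] at h1
    intro q l hl
    by_cases hq : q ∈ U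
    · rw [expVal_concat_tail M α β _ t m q l (by simpa using hl)]
      simpa [ind, hq] using hS q hq
    · simpa [ind, hq] using expVal_nonneg M (α.concat t β) (ind_nonneg S) m q l
  refine ⟨α.concat t β, t + m, le_antisymm (expVal_ind_le_one M _ _ _ _ _)
    (key U 1 fun q hq => (hβ q hq).2.ge), by omega, hagree,
    key T (1 - ε) fun q hq => le_trans ?_ (hβ q hq).1⟩
  have := min_le_left ε (1 / 2)
  linarith

/-- Iterating the extensions gives an almost-sure winning strategy. -/
lemma exists_almost_sure_of_sure_of_limit_sure {q0 : Q} {T U : Finset Q}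
    (hlim : ∀ ε : ℝ, 0 < ε → ∃ (β : Strat Q A) (m : ℕ), ∀ q ∈ U,
      1 - ε ≤ expVal M β (ind T) m q [] ∧ expVal M β (ind U) m q [] = 1)
    (α : Strat Q A) (t : ℕ) (hα : expVal M α (ind U) t q0 [] = 1) :
    ∃ α' : Strat Q A, ∀ ε : ℝ, 0 < ε → ∃ n : ℕ, 1 - ε ≤ expVal M α' (ind T) n q0 [] := by
  by_cases hUT : U ⊆ T
  · refine ⟨α, fun ε hε => ⟨t, ?_⟩⟩
    have h1 : expVal M α (ind U) t q0 [] ≤ expVal M α (ind T) t q0 [] := by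
      refine expVal_mono M α (fun q => ?_) t q0 []
      by_cases hq : q ∈ U
      · simp [ind, hq, hUT hq]
      · simpa [ind, hq] using ind_nonneg T q
    linarith
  let Stage := {s : Strat Q A × ℕ // expVal M s.1 (ind U) s.2 q0 [] = 1}
  have hext : ∀ (k : ℕ) (s : Stage), ∃ s' : Stage, s.1.2 < s'.1.2 ∧
      (∀ l : List Q, l.length ≤ s.1.2 → s'.1.1.σ l = s.1.1.σ l) ∧
      1 - 1 / ((k : ℝ) + 1) ≤ expVal M s'.1.1 (ind T) s'.1.2 q0 [] := by
    rintro k ⟨⟨β, m⟩, hs⟩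
    obtain ⟨β', m', h1, h2⟩ := exists_extension M hUT hlim β m hs
      (ε := 1 / ((k : ℝ) + 1)) Nat.one_div_pos_of_nat
    exact ⟨⟨(β', m'), h1⟩, h2⟩
  choose next hnext using hext
  let S : ℕ → Stage := fun k => Nat.rec ⟨(α, t), hα⟩ (fun k s => next k s) k
  have hS : ∀ k, S (k + 1) = next k (S k) := fun k => rfl
  have hmono : StrictMono fun k => (S k).1.2 :=
    strictMono_nat_of_lt_succ fun k => by rw [hS]; exact (hnext k (S k)).1
  have hagree : ∀ j k, j ≤ k → ∀ l : List Q, l.length ≤ (S j).1.2 →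
      (S k).1.1.σ l = (S j).1.1.σ l := by
    intro j k hjk l hl
    induction k, hjk using Nat.le_induction with
    | base => rfl
    | succ k hjk ih =>
      rw [← ih, hS]
      exact (hnext k (S k)).2.1 l (hl.trans (hmono.monotone hjk))
  let α' : Strat Q A :=
    { σ := fun l => (S l.length).1.1.σ l
      nonneg := fun l a => (S l.length).1.1.nonneg l a
      sum_one := fun l => (S l.length).1.1.sum_one l }
  have hα' : ∀ (k : ℕ) (l : List Q), l.length ≤ (S k).1.2 → α'.σ l = (S k).1.1.σ l := by
    intro k l hl
    rcases le_total k l.length with hk | hk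
    · exact hagree k l.length hk l hl
    · exact (hagree l.length k hk l (hmono.id_le l.length)).symm
  refine ⟨α', fun ε hε => ?_⟩
  obtain ⟨k, hk⟩ := exists_nat_one_div_lt hε
  refine ⟨(S (k + 1)).1.2, ?_⟩
  rw [expVal_congr M (β := (S (k + 1)).1.1) _ _ _ _
    fun l hl => hα' (k + 1) l (by simpa using hl)]
  have h1 := (hnext k (S k)).2.2
  rw [← hS] at h1
  linarith

end main

/-- Characterization of almost-sure eventually synchronizing: a Dirac initial state
`q₀` is almost-sure winning for eventually synchronizing in `T` iff there is a set
`U` such that `q₀` is sure eventually synchronizing in `U` and the uniform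
distribution on `U` is limit-sure eventually synchronizing in `T` with support
in `U`. -/
theorem almost_sure_eventually_characterization {Q A : Type} [Fintype Q]
    [DecidableEq Q] [Fintype A] [Nonempty Q] [Nonempty A]
    (M : MDP Q A) (q0 : Q) (T : Finset Q) :
    (∃ α : Strat Q A, ∀ ε : ℝ, 0 < ε → ∃ n : ℕ,
        1 - ε ≤ Mmass M (dirac q0) α n T) ↔
      ∃ U : Finset Q, U.Nonempty ∧
        (∃ (α : Strat Q A) (n : ℕ), Mmass M (dirac q0) α n U = 1) ∧
        (∀ ε : ℝ, 0 < ε → ∃ (α : Strat Q A) (n : ℕ),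
          1 - ε ≤ Mmass M (uniformOn U) α n T ∧ Mmass M (uniformOn U) α n U = 1) := by
  constructor
  · rintro ⟨α, hα⟩
    simp only [Mmass_dirac] at hα
    obtain ⟨U, n, β, hU, hβ⟩ := exists_support_of_almost_sure M q0 T α hα
    have hne : U.Nonempty := by
      rw [Finset.nonempty_iff_ne_empty]
      rintro rfl
      rw [expVal_eq_sum] at hU
      simp [ind] at hU
    refine ⟨U, hne, ⟨α, n, by rw [Mmass_dirac, hU]⟩, fun ε hε => ?_⟩
    obtain ⟨m, hm⟩ := hβ ε hε
    exact ⟨β, m, le_Mmass_uniformOn M β hne m T fun q hq => (hm q hq).1,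
      le_antisymm (Mmass_uniformOn_le_one M β hne m U)
        (le_Mmass_uniformOn M β hne m U fun q hq => (hm q hq).2.ge)⟩
  · rintro ⟨U, hne, ⟨α, t, hα⟩, hlim⟩
    rw [Mmass_dirac] at hα
    simp only [Mmass_dirac]
    refine exists_almost_sure_of_sure_of_limit_sure M (U := U) (fun ε hε => ?_) α t hα
    obtain ⟨β, m, hT, hU⟩ :=
      hlim (ε / U.card) (div_pos hε (by exact_mod_cast hne.card_pos))
    refine ⟨β, m, fun q hq => ⟨le_expVal_of_le_Mmass_uniformOn M β m T hT hq,
      le_antisymm (expVal_ind_le_one M β U m q []) ?_⟩⟩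
    have h1 := le_expVal_of_le_Mmass_uniformOn M β m U (ε := 0) (by simp [hU]) hq
    simpa using h1
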